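/- Every real group structure on an n-dimensional complex torus T ≅ G_m^n is equivalent to exactly one real group structure of the form σ₀^{×n₀} × σ₁^{×n₁} × σ₂^{×n₂} with n = n₀ + n₁ + 2n₂, where σ₀(t) = conj(t), σ₁(t) = conj(t)⁻¹, and σ₂(t₁,t₂) = (conj(t₂), conj(t₁)). -/

import Mathlib

/-- Complex conjugation on `ℂˣ`. -/
noncomputable def conjUnits : ℂˣ →* ℂˣ := Units.map (starRingEnd ℂ).toMonoidHom

/-- An endomorphism of the torus `(ℂˣ)ⁿ` is algebraic (regular) iff it is given by an
integer matrix of exponents. -/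
def IsAlgebraicEnd {n : ℕ} (f : (Fin n → ℂˣ) → (Fin n → ℂˣ)) : Prop :=
  ∃ M : Matrix (Fin n) (Fin n) ℤ, ∀ z i, f z i = ∏ j, (z j) ^ (M i j)

/-- A real group structure on the `n`-dimensional complex torus `(ℂˣ)ⁿ`: an
antiregular group involution. -/
def IsRealGroupStructure {n : ℕ} (σ : (Fin n → ℂˣ) → (Fin n → ℂˣ)) : Prop :=
  (∀ z w, σ (z * w) = σ z * σ w) ∧ (∀ z, σ (σ z) = z) ∧
    IsAlgebraicEnd (fun z i => conjUnits (σ z i))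

/-- The standard real group structure `σ₀^{×n₀} × σ₁^{×n₁} × σ₂^{×n₂}` on the torus of
dimension `n₀ + n₁ + 2n₂`: the first `n₀` coordinates are conjugated, the next `n₁`
coordinates are conjugated and inverted, and the remaining `2n₂` coordinates are
conjugated and swapped in consecutive pairs. -/
noncomputable def stdStructure (n₀ n₁ n₂ : ℕ)
    (z : Fin (n₀ + n₁ + 2 * n₂) → ℂˣ) (i : Fin (n₀ + n₁ + 2 * n₂)) : ℂˣ :=
  if h₀ : (i : ℕ) < n₀ then conjUnits (z i)
  else if h₁ : (i : ℕ) < n₀ + n₁ then (conjUnits (z i))⁻¹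
  else if h₂ : ((i : ℕ) - (n₀ + n₁)) % 2 = 0 then
    conjUnits (z ⟨(i : ℕ) + 1, by have := i.isLt; omega⟩)
  else
    conjUnits (z ⟨(i : ℕ) - 1, by have := i.isLt; omega⟩)

/-- Reindexing of a torus endomorphism along an equality of dimensions. -/
def reindex {m n : ℕ} (h : m = n) (σ : (Fin m → ℂˣ) → (Fin m → ℂˣ)) :
    (Fin n → ℂˣ) → (Fin n → ℂˣ) :=
  fun z i => σ (fun j => z (Fin.cast h j)) (Fin.cast h.symm i)

/-- Two real group structures are equivalent if conjugate by an algebraic group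
automorphism of the torus. -/
def EquivStruct {n : ℕ} (σ σ' : (Fin n → ℂˣ) → (Fin n → ℂˣ)) : Prop :=
  ∃ ψ : (Fin n → ℂˣ) ≃* (Fin n → ℂˣ), IsAlgebraicEnd ψ ∧ IsAlgebraicEnd ψ.symm ∧
    ∀ z, σ' z = ψ (σ (ψ.symm z))


theorem basis_map_mem {ι M L : Type*} [AddCommGroup M] [AddCommGroup L] (b : Module.Basis ι ℤ M)
    (f : M →ₗ[ℤ] L) (W : Submodule ℤ L) (h : ∀ i, f (b i) ∈ W) (x : M) : f x ∈ W := by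
  have hx : x ∈ Submodule.span ℤ (Set.range b) := b.mem_span x
  have : Submodule.span ℤ (Set.range b) ≤ W.comap f := by
    rw [Submodule.span_le]
    rintro _ ⟨i, rfl⟩
    exact h i
  exact this hx

theorem involution_core (n : ℕ) (s : (Fin n → ℤ) →ₗ[ℤ] (Fin n → ℤ)) (hs : ∀ x, s (s x) = x) :
    ∃ (I₀ I₁ I₂ : Type) (_ : Fintype I₀) (_ : Fintype I₁) (_ : Fintype I₂)
      (e₀ : I₀ → Fin n → ℤ) (e₁ : I₁ → Fin n → ℤ) (u : I₂ → Fin n → ℤ),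
      Fintype.card I₀ + Fintype.card I₁ + 2 * Fintype.card I₂ = n ∧
      (∀ i, s (e₀ i) = e₀ i) ∧ (∀ i, s (e₁ i) = - e₁ i) ∧
      ∀ W : Submodule ℤ (Fin n → ℤ), (∀ i, e₀ i ∈ W) → (∀ i, e₁ i ∈ W) → (∀ i, u i ∈ W) →
        (∀ i, s (u i) ∈ W) → W = ⊤ := by
  classical
  let L := Fin n → ℤ
  let D : L →ₗ[ℤ] L := s - LinearMap.id
  obtain ⟨g, hg⟩ := Module.projective_lifting_property D.rangeRestrict LinearMap.id
    D.surjective_rangeRestrict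
  have hg' : ∀ r, D (g r) = r := fun r => congrArg Subtype.val (LinearMap.congr_fun hg r)
  let A : LinearMap.range D →ₗ[ℤ] L := (s + LinearMap.id) ∘ₗ g
  have hA : LinearMap.range A ≤ LinearMap.ker D := by
    rintro _ ⟨r, rfl⟩
    simp only [A, D, LinearMap.mem_ker, LinearMap.comp_apply, LinearMap.add_apply,
      LinearMap.sub_apply, LinearMap.id_apply, map_add, hs]
    abel
  obtain ⟨h, hh⟩ := Module.projective_lifting_property A.rangeRestrict LinearMap.id
    A.surjective_rangeRestrict
  have hh' : ∀ r, A (h r) = r := fun r => congrArg Subtype.val (LinearMap.congr_fun hh r)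
  obtain ⟨m, o, hmo, bO, bN, a, ha⟩ := Submodule.exists_smith_normal_form_of_le
    (Pi.basisFun ℤ (Fin n)) _ _ hA
  obtain ⟨κ, d⟩ := Submodule.basisOfPid (Module.finBasis ℤ (LinearMap.range D)) (LinearMap.ker A)
  have hcard : o + m + κ = n := by
    have h1 := Submodule.finrank_quotient_add_finrank (LinearMap.ker D)
    have h2 := Submodule.finrank_quotient_add_finrank (LinearMap.ker A)
    rw [D.quotKerEquivRange.finrank_eq] at h1
    rw [A.quotKerEquivRange.finrank_eq] at h2
    rw [Module.finrank_eq_card_basis bO] at h1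
    rw [Module.finrank_eq_card_basis bN, Module.finrank_eq_card_basis d] at h2
    simp [L] at h1 h2
    omega
  let ι := Fin.castLE hmo
  have hι : Function.Injective ι := Fin.castLE_injective hmo
  let c : Fin m → L := fun k => g (h (bN k)) - (a k / 2) • (bO (ι k) : L)
  have hsO : ∀ i, s (bO i) = bO i := fun i => by
    have := (bO i).2
    rw [LinearMap.mem_ker] at this
    exact sub_eq_zero.1 this
  have hsc : ∀ k, s (c k) + c k = (a k % 2) • (bO (ι k) : L) := fun k => by
    have h1 : s (g (h (bN k))) + g (h (bN k)) = a k • (bO (ι k) : L) := by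
      have := hh' (bN k)
      rw [ha k] at this
      simpa [A] using this
    have h2 : a k = a k % 2 + 2 * (a k / 2) := (Int.emod_add_mul_ediv _ _).symm
    simp only [c, map_sub, map_smul, hsO]
    have h3 : (a k % 2) • (bO (ι k) : L) = (a k) • (bO (ι k) : L) - (2 * (a k / 2)) • (bO (ι k) : L) := by
      rw [← sub_smul]; congr 1; omega
    rw [h3, ← h1, two_mul, add_smul]
    abel
  have hsd : ∀ l, s (g (d l)) = - g (d l) := fun l => by
    have := (d l).2
    rw [LinearMap.mem_ker] at this
    exact eq_neg_of_add_eq_zero_left this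
  let I₂ := {k : Fin m // a k % 2 = 1}
  let J : Finset (Fin o) := (Finset.univ.filter fun k => a k % 2 = 1).map ⟨ι, hι⟩
  refine ⟨{i : Fin o // i ∉ J}, Fin κ ⊕ {k : Fin m // ¬ a k % 2 = 1}, I₂, inferInstance,
    inferInstance, inferInstance, fun i => bO i.1, Sum.elim (fun l => g (d l)) (fun k => c k.1),
    fun k => c k.1, ?_, ?_, ?_, ?_⟩
  · have h1 : Fintype.card {i : Fin o // i ∉ J} = o - Fintype.card I₂ := by
      rw [Fintype.card_subtype_compl, Fintype.card_fin, Fintype.card_subtype,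
        Finset.filter_univ_mem, Finset.card_map, Fintype.card_subtype]
    have h2 : Fintype.card {k : Fin m // ¬ a k % 2 = 1} = m - Fintype.card I₂ := by
      rw [Fintype.card_subtype_compl]; simp [I₂]
    have h3 : Fintype.card I₂ ≤ m := by
      simpa using Fintype.card_subtype_le (fun k : Fin m => a k % 2 = 1)
    rw [Fintype.card_sum, h1, h2, Fintype.card_fin]
    omega
  · intro i; exact hsO _
  · rintro (l | k)
    · exact hsd l
    · have := hsc k.1
      have h0 : a k.1 % 2 = 0 := by have := k.2; omega
      rw [h0, zero_smul] at this
      exact eq_neg_of_add_eq_zero_left this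
  · intro W h0 h1 h2 h3
    have hO : ∀ i, (bO i : L) ∈ W := by
      intro i
      by_cases hi : i ∈ J
      · simp only [J, Finset.mem_map, Finset.mem_filter, Finset.mem_univ, true_and] at hi
        obtain ⟨k, hk, rfl⟩ := hi
        have := hsc k
        rw [hk, one_smul] at this
        change (bO (ι k) : L) ∈ W
        rw [← this]
        exact W.add_mem (h3 ⟨k, hk⟩) (h2 ⟨k, hk⟩)
      · exact h0 ⟨i, hi⟩
    have hc : ∀ k, c k ∈ W := fun k => by
      by_cases hk : a k % 2 = 1
      · exact h2 ⟨k, hk⟩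
      · exact h1 (Sum.inr ⟨k, hk⟩)
    have hgh : ∀ k, g (h (bN k)) ∈ W := fun k => by
      have : g (h (bN k)) = c k + (a k / 2) • (bO (ι k) : L) := by simp [c]
      rw [this]
      exact W.add_mem (hc k) (W.smul_mem _ (hO _))
    have hK := basis_map_mem d (g ∘ₗ (LinearMap.ker A).subtype) W (fun l => h1 (Sum.inl l))
    have hN := basis_map_mem bN (g ∘ₗ h) W hgh
    have hP := basis_map_mem bO (LinearMap.ker D).subtype W hO
    have hR : ∀ r, g r ∈ W := fun r => by
      have e1 : g r = g (h (A.rangeRestrict r)) + g (r - h (A.rangeRestrict r)) := by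
        rw [← map_add]; simp
      rw [e1]
      refine W.add_mem (hN _) (hK ⟨r - h (A.rangeRestrict r), ?_⟩)
      rw [LinearMap.mem_ker, map_sub, hh']; simp
    rw [eq_top_iff]
    rintro x -
    have e1 : x = g (D.rangeRestrict x) + (x - g (D.rangeRestrict x)) := by abel
    rw [e1]
    refine W.add_mem (hR _) (hP ⟨x - g (D.rangeRestrict x), ?_⟩)
    rw [LinearMap.mem_ker, map_sub, hg']; simp

theorem involution_fin (n : ℕ) (s : (Fin n → ℤ) →ₗ[ℤ] (Fin n → ℤ)) (hs : ∀ x, s (s x) = x) :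
    ∃ (n₀ n₁ n₂ : ℕ) (e₀ : Fin n₀ → Fin n → ℤ) (e₁ : Fin n₁ → Fin n → ℤ)
      (u : Fin n₂ → Fin n → ℤ),
      n₀ + n₁ + 2 * n₂ = n ∧
      (∀ i, s (e₀ i) = e₀ i) ∧ (∀ i, s (e₁ i) = - e₁ i) ∧
      ∀ W : Submodule ℤ (Fin n → ℤ), (∀ i, e₀ i ∈ W) → (∀ i, e₁ i ∈ W) → (∀ i, u i ∈ W) →
        (∀ i, s (u i) ∈ W) → W = ⊤ := by
  obtain ⟨I₀, I₁, I₂, _, _, _, e₀, e₁, u, hc, h0, h1, hW⟩ := involution_core n s hs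
  refine ⟨_, _, _, e₀ ∘ (Fintype.equivFin I₀).symm, e₁ ∘ (Fintype.equivFin I₁).symm,
    u ∘ (Fintype.equivFin I₂).symm, hc, fun i => h0 _, fun i => h1 _, ?_⟩
  intro W a0 a1 a2 a3
  refine hW W (fun i => ?_) (fun i => ?_) (fun i => ?_) (fun i => ?_)
  · simpa using a0 (Fintype.equivFin I₀ i)
  · simpa using a1 (Fintype.equivFin I₁ i)
  · simpa using a2 (Fintype.equivFin I₂ i)
  · simpa using a3 (Fintype.equivFin I₂ i)

/-- Monomial map attached to an integer matrix. -/
def monomialMap {n : ℕ} (M : Matrix (Fin n) (Fin n) ℤ) (z : Fin n → ℂˣ) (i : Fin n) : ℂˣ :=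
  ∏ j, z j ^ M i j

theorem monomialMap_mul {n : ℕ} (M N : Matrix (Fin n) (Fin n) ℤ) (z : Fin n → ℂˣ) :
    monomialMap M (monomialMap N z) = monomialMap (M * N) z := by
  funext i
  simp only [monomialMap, Matrix.mul_apply, ← Finset.prod_zpow]
  rw [Finset.prod_comm]
  refine Finset.prod_congr rfl fun k _ => ?_
  have : ∀ t : Finset (Fin n), z k ^ (∑ j ∈ t, M i j * N j k) = ∏ j ∈ t, (z k ^ N j k) ^ M i j := by
    intro t
    classical
    induction t using Finset.induction_on with
    | empty => simp
    | insert a t hat ih =>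
      rw [Finset.sum_insert hat, Finset.prod_insert hat, zpow_add, ih, mul_comm (M i a), zpow_mul]
  rw [this]

theorem monomialMap_one {n : ℕ} (z : Fin n → ℂˣ) : monomialMap 1 z = z := by
  funext i
  rw [monomialMap, Finset.prod_eq_single i]
  · simp
  · intro j _ hj
    simp [Matrix.one_apply_ne hj.symm]
  · simp

theorem monomialMap_map_mul {n : ℕ} (M : Matrix (Fin n) (Fin n) ℤ) (z w : Fin n → ℂˣ) :
    monomialMap M (z * w) = monomialMap M z * monomialMap M w := by
  funext i
  simp [monomialMap, mul_zpow, Finset.prod_mul_distrib]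

theorem monomialMap_conj {n : ℕ} (M : Matrix (Fin n) (Fin n) ℤ) (z : Fin n → ℂˣ) :
    monomialMap M (fun i => conjUnits (z i)) = fun i => conjUnits (monomialMap M z i) := by
  funext i
  simp [monomialMap, map_prod, map_zpow]

theorem conjUnits_conjUnits (t : ℂˣ) : conjUnits (conjUnits t) = t := by
  ext
  simp [conjUnits]

theorem monomialMap_inj {n : ℕ} (M N : Matrix (Fin n) (Fin n) ℤ)
    (h : ∀ z, monomialMap M z = monomialMap N z) : M = N := by
  ext i k
  have h1 := congrFun (h (Pi.mulSingle k (Units.mk0 2 two_ne_zero))) i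
  have key : ∀ M : Matrix (Fin n) (Fin n) ℤ,
      monomialMap M (Pi.mulSingle k (Units.mk0 2 two_ne_zero)) i
        = (Units.mk0 (2 : ℂ) two_ne_zero) ^ M i k := by
    intro M
    rw [monomialMap, Finset.prod_eq_single k]
    · simp
    · intro j _ hj
      simp [Pi.mulSingle_eq_of_ne hj]
    · simp
  rw [key, key] at h1
  have h2 := congrArg (fun t : ℂˣ => ‖(t : ℂ)‖) h1
  simp only [Units.val_zpow_eq_zpow_val, Units.val_mk0, norm_zpow, Complex.norm_ofNat] at h2
  exact zpow_right_injective₀ (by norm_num) (by norm_num) h2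

theorem exists_matrix {n₀ n₁ n₂ : ℕ}
    (s : (Fin (n₀ + n₁ + 2 * n₂) → ℤ) →ₗ[ℤ] (Fin (n₀ + n₁ + 2 * n₂) → ℤ))
    (hs : ∀ x, s (s x) = x)
    (e₀ : Fin n₀ → Fin (n₀ + n₁ + 2 * n₂) → ℤ) (e₁ : Fin n₁ → Fin (n₀ + n₁ + 2 * n₂) → ℤ)
    (u : Fin n₂ → Fin (n₀ + n₁ + 2 * n₂) → ℤ)
    (h0 : ∀ i, s (e₀ i) = e₀ i) (h1 : ∀ i, s (e₁ i) = - e₁ i)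
    (hW : ∀ W : Submodule ℤ (Fin (n₀ + n₁ + 2 * n₂) → ℤ), (∀ i, e₀ i ∈ W) → (∀ i, e₁ i ∈ W) →
      (∀ i, u i ∈ W) → (∀ i, s (u i) ∈ W) → W = ⊤) :
    ∃ P Q : Matrix (Fin (n₀ + n₁ + 2 * n₂)) (Fin (n₀ + n₁ + 2 * n₂)) ℤ, P * Q = 1 ∧ Q * P = 1 ∧
      ∀ i, s (P i) = if h₀ : (i : ℕ) < n₀ then P i
        else if h₁ : (i : ℕ) < n₀ + n₁ then - P i
        else if h₂ : ((i : ℕ) - (n₀ + n₁)) % 2 = 0 then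
          P ⟨(i : ℕ) + 1, by have := i.isLt; omega⟩
        else P ⟨(i : ℕ) - 1, by have := i.isLt; omega⟩ := by
  let P : Matrix (Fin (n₀ + n₁ + 2 * n₂)) (Fin (n₀ + n₁ + 2 * n₂)) ℤ := fun i =>
    if h₀ : (i : ℕ) < n₀ then e₀ ⟨i, h₀⟩
    else if h₁ : (i : ℕ) < n₀ + n₁ then e₁ ⟨i - n₀, by omega⟩
    else if h₂ : ((i : ℕ) - (n₀ + n₁)) % 2 = 0 then
      u ⟨((i : ℕ) - (n₀ + n₁)) / 2, by have := i.isLt; omega⟩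
    else s (u ⟨((i : ℕ) - (n₀ + n₁)) / 2, by have := i.isLt; omega⟩)
  have hspan : ⊤ ≤ Submodule.span ℤ (Set.range P) := by
    refine (hW _ ?_ ?_ ?_ ?_).ge
    · intro i
      refine Submodule.subset_span ⟨⟨i, by omega⟩, ?_⟩
      simp [P]
    · intro i
      refine Submodule.subset_span ⟨⟨n₀ + i, by omega⟩, ?_⟩
      simp [P]
    · intro i
      refine Submodule.subset_span ⟨⟨n₀ + n₁ + 2 * i, by omega⟩, ?_⟩
      have a1 : ¬ (n₀ + n₁ + 2 * (i : ℕ) < n₀) := by omega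
      simp [P, a1]
    · intro i
      refine Submodule.subset_span ⟨⟨n₀ + n₁ + (2 * i + 1), by omega⟩, ?_⟩
      have a1 : ¬ (n₀ + n₁ + (2 * (i : ℕ) + 1) < n₀) := by omega
      have a3 : (2 * (i : ℕ) + 1) / 2 = i := by omega
      simp [P, a1, a3]
  let b := basisOfTopLeSpanOfCardEqFinrank P hspan (by simp)
  have hb : ⇑b = P := coe_basisOfTopLeSpanOfCardEqFinrank P hspan (by simp)
  let B := Pi.basisFun ℤ (Fin (n₀ + n₁ + 2 * n₂))
  have hP : P = (B.toMatrix b).transpose := by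
    ext i j
    rw [Matrix.transpose_apply, Module.Basis.toMatrix_apply, hb]
    simp [B]
  refine ⟨P, (b.toMatrix B).transpose, ?_, ?_, ?_⟩
  · rw [hP, ← Matrix.transpose_mul, Module.Basis.toMatrix_mul_toMatrix_flip, Matrix.transpose_one]
  · rw [hP, ← Matrix.transpose_mul, Module.Basis.toMatrix_mul_toMatrix_flip, Matrix.transpose_one]
  · intro i
    by_cases c0 : (i : ℕ) < n₀
    · simp [P, c0, h0]
    by_cases c1 : (i : ℕ) < n₀ + n₁
    · simp [P, c0, c1, h1]
    by_cases c2 : ((i : ℕ) - (n₀ + n₁)) % 2 = 0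
    · have a1 : ¬ ((i : ℕ) + 1 < n₀) := by omega
      have a2 : ¬ ((i : ℕ) + 1 < n₀ + n₁) := by omega
      have a3 : ¬ (((i : ℕ) + 1 - (n₀ + n₁)) % 2 = 0) := by omega
      have a4 : ((i : ℕ) + 1 - (n₀ + n₁)) / 2 = ((i : ℕ) - (n₀ + n₁)) / 2 := by omega
      simp only [P, c0, c1, c2, a1, a2, a3, a4, dite_true, dite_false]
    · have a1 : ¬ ((i : ℕ) - 1 < n₀) := by omega
      have a2 : ¬ ((i : ℕ) - 1 < n₀ + n₁) := by omega
      have a3 : (((i : ℕ) - 1 - (n₀ + n₁)) % 2 = 0) := by omega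
      have a4 : ((i : ℕ) - 1 - (n₀ + n₁)) / 2 = ((i : ℕ) - (n₀ + n₁)) / 2 := by omega
      simp only [P, c0, c1, c2, a1, a2, a3, a4, dite_true, dite_false, hs]

theorem exists_std (n : ℕ) (σ : (Fin n → ℂˣ) → (Fin n → ℂˣ))
    (hσ : IsRealGroupStructure σ) :
    ∃ t : ℕ × ℕ × ℕ, ∃ h : t.1 + t.2.1 + 2 * t.2.2 = n,
      EquivStruct σ (reindex h (stdStructure t.1 t.2.1 t.2.2)) := by
  obtain ⟨-, hinv, M, hM⟩ := hσ
  have hσ' : ∀ z, σ z = fun i => conjUnits (monomialMap M z i) := by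
    intro z
    funext i
    rw [monomialMap, ← hM z i, conjUnits_conjUnits]
  have hMM : M * M = 1 := by
    apply monomialMap_inj
    intro z
    rw [monomialMap_one, ← monomialMap_mul]
    have := hinv z
    rw [hσ' (σ z), hσ' z, monomialMap_conj] at this
    simpa only [conjUnits_conjUnits] using this
  have hs : ∀ x, M.vecMulLinear (M.vecMulLinear x) = x := by
    intro x
    simp [Matrix.vecMul_vecMul, hMM]
  obtain ⟨n₀, n₁, n₂, e₀, e₁, u, rfl, h0, h1, hW⟩ := involution_fin n M.vecMulLinear hs
  obtain ⟨P, Q, hPQ, hQP, hP⟩ := exists_matrix M.vecMulLinear hs e₀ e₁ u h0 h1 hW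
  let ψ : (Fin (n₀ + n₁ + 2 * n₂) → ℂˣ) ≃* (Fin (n₀ + n₁ + 2 * n₂) → ℂˣ) :=
    { toFun := monomialMap P
      invFun := monomialMap Q
      left_inv := fun z => by rw [monomialMap_mul, hQP, monomialMap_one]
      right_inv := fun z => by rw [monomialMap_mul, hPQ, monomialMap_one]
      map_mul' := monomialMap_map_mul P }
  refine ⟨(n₀, n₁, n₂), rfl, ψ, ⟨P, fun z i => rfl⟩, ⟨Q, fun z i => rfl⟩, ?_⟩
  have key : ∀ z, stdStructure n₀ n₁ n₂ (monomialMap P z) = monomialMap P (σ z) := by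
    intro z
    rw [hσ', monomialMap_conj, monomialMap_mul]
    funext i
    have hrow : (P * M) i = M.vecMulLinear (P i) := by
      rw [Matrix.vecMulLinear_apply, Matrix.mul_apply_eq_vecMul]
    have hz : monomialMap (P * M) z i = ∏ j, z j ^ (M.vecMulLinear (P i)) j := by
      rw [monomialMap, hrow]
    rw [hz, hP i]
    unfold stdStructure
    split_ifs
    · rfl
    · rw [← map_inv]
      simp [monomialMap]
    · rfl
    · rfl
  intro z
  have := key (ψ.symm z)
  change _ = ψ _ at this
  rw [← this]
  change stdStructure n₀ n₁ n₂ z = stdStructure n₀ n₁ n₂ (ψ (ψ.symm z))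
  rw [MulEquiv.apply_symm_apply]

/-- Fixed `k`-torsion of the standard structure. -/
noncomputable def fixedEquiv (k n₀ n₁ n₂ : ℕ) :
    {z : Fin (n₀ + n₁ + 2 * n₂) → ℂˣ // z ^ k = 1 ∧ stdStructure n₀ n₁ n₂ z = z} ≃
      (Fin n₀ → {t : ℂˣ // t ^ k = 1 ∧ conjUnits t = t}) ×
      (Fin n₁ → {t : ℂˣ // t ^ k = 1 ∧ (conjUnits t)⁻¹ = t}) ×
      (Fin n₂ → {t : ℂˣ // t ^ k = 1}) where
  toFun z :=
    (fun i => ⟨z.1 ⟨i, by omega⟩, congrFun z.2.1 _, by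
      have := congrFun z.2.2 ⟨i, by omega⟩
      simpa [stdStructure] using this⟩,
     fun i => ⟨z.1 ⟨n₀ + i, by omega⟩, congrFun z.2.1 _, by
      have := congrFun z.2.2 ⟨n₀ + i, by omega⟩
      simpa [stdStructure] using this⟩,
     fun i => ⟨z.1 ⟨n₀ + n₁ + 2 * i, by omega⟩, congrFun z.2.1 _⟩)
  invFun w := ⟨fun i =>
    if h₀ : (i : ℕ) < n₀ then (w.1 ⟨i, h₀⟩).1
    else if h₁ : (i : ℕ) < n₀ + n₁ then (w.2.1 ⟨i - n₀, by omega⟩).1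
    else if h₂ : ((i : ℕ) - (n₀ + n₁)) % 2 = 0 then
      (w.2.2 ⟨((i : ℕ) - (n₀ + n₁)) / 2, by have := i.isLt; omega⟩).1
    else conjUnits (w.2.2 ⟨((i : ℕ) - (n₀ + n₁)) / 2, by have := i.isLt; omega⟩).1, by
      constructor
      · funext i
        simp only [Pi.pow_apply, Pi.one_apply]
        split_ifs
        · exact (w.1 _).2.1
        · exact (w.2.1 _).2.1
        · exact (w.2.2 _).2
        · rw [← map_pow, (w.2.2 _).2, map_one]
      · funext i
        by_cases c0 : (i : ℕ) < n₀
        · simpa [stdStructure, c0] using (w.1 _).2.2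
        by_cases c1 : (i : ℕ) < n₀ + n₁
        · simpa [stdStructure, c0, c1] using (w.2.1 _).2.2
        by_cases c2 : ((i : ℕ) - (n₀ + n₁)) % 2 = 0
        · have a1 : ¬ ((i : ℕ) + 1 < n₀) := by omega
          have a2 : ¬ ((i : ℕ) + 1 < n₀ + n₁) := by omega
          have a3 : ¬ (((i : ℕ) + 1 - (n₀ + n₁)) % 2 = 0) := by omega
          have a4 : ((i : ℕ) + 1 - (n₀ + n₁)) / 2 = ((i : ℕ) - (n₀ + n₁)) / 2 := by omega
          simp only [stdStructure, c0, c1, c2, a1, a2, a3, a4, dite_true, dite_false,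
            conjUnits_conjUnits]
        · have a1 : ¬ ((i : ℕ) - 1 < n₀) := by omega
          have a2 : ¬ ((i : ℕ) - 1 < n₀ + n₁) := by omega
          have a3 : (((i : ℕ) - 1 - (n₀ + n₁)) % 2 = 0) := by omega
          have a4 : ((i : ℕ) - 1 - (n₀ + n₁)) / 2 = ((i : ℕ) - (n₀ + n₁)) / 2 := by omega
          simp only [stdStructure, c0, c1, c2, a1, a2, a3, a4, dite_true, dite_false]⟩
  left_inv z := by
    apply Subtype.ext
    funext i
    dsimp only
    split_ifs with c0 c1 c2
    · rfl
    · exact congrArg z.1 (Fin.ext (by dsimp only; omega))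
    · exact congrArg z.1 (Fin.ext (by dsimp only; omega))
    · have := congrFun z.2.2 i
      simp only [stdStructure, c0, c1, c2, dite_false] at this
      rw [← this]
      exact congrArg (fun j => conjUnits (z.1 j)) (Fin.ext (by dsimp only; omega))
  right_inv w := by
    refine Prod.ext ?_ (Prod.ext ?_ ?_)
    · funext i; apply Subtype.ext; simp
    · funext i; apply Subtype.ext; simp
    · funext i; apply Subtype.ext
      have a1 : ¬ (n₀ + n₁ + 2 * (i : ℕ) < n₀) := by omega
      simp [a1]

theorem card_torsion (k : ℕ) [NeZero k] : Nat.card {t : ℂˣ // t ^ k = 1} = k := by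
  refine Eq.trans ?_ (Complex.card_rootsOfUnity k)
  exact Nat.card_congr (Equiv.subtypeEquivRight fun t => (mem_rootsOfUnity k t).symm)

theorem conj_torsion (k : ℕ) [NeZero k] (t : ℂˣ) (h : t ^ k = 1) : conjUnits t = t⁻¹ := by
  ext
  have := Complex.norm_eq_one_of_pow_eq_one (n := k) (ζ := (t : ℂ))
    (by rw [← Units.val_pow_eq_pow_val, h, Units.val_one]) (NeZero.ne k)
  simp [conjUnits, Complex.inv_def, Complex.normSq_eq_norm_sq, this]

theorem card_B (k : ℕ) [NeZero k] :
    Nat.card {t : ℂˣ // t ^ k = 1 ∧ (conjUnits t)⁻¹ = t} = k := by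
  refine Eq.trans ?_ (card_torsion k)
  refine Nat.card_congr (Equiv.subtypeEquivRight fun t => ⟨fun h => h.1, fun h => ⟨h, ?_⟩⟩)
  rw [conj_torsion k t h, inv_inv]

theorem card_A2 : Nat.card {t : ℂˣ // t ^ 2 = 1 ∧ conjUnits t = t} = 2 := by
  refine Eq.trans ?_ (card_torsion 2)
  refine Nat.card_congr (Equiv.subtypeEquivRight fun t => ⟨fun h => h.1, fun h => ⟨h, ?_⟩⟩)
  rw [conj_torsion 2 t h, inv_eq_iff_mul_eq_one, ← sq, h]

theorem card_A3 : Nat.card {t : ℂˣ // t ^ 3 = 1 ∧ conjUnits t = t} = 1 := by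
  rw [Nat.card_eq_one_iff_unique]
  refine ⟨⟨fun a b => ?_⟩, ⟨⟨1, by simp⟩⟩⟩
  have key : ∀ t : ℂˣ, t ^ 3 = 1 → conjUnits t = t → t = 1 := by
    intro t h h'
    rw [conj_torsion 3 t h, inv_eq_iff_mul_eq_one] at h'
    rwa [pow_succ, sq, h', one_mul] at h
  apply Subtype.ext
  rw [key a.1 a.2.1 a.2.2, key b.1 b.2.1 b.2.2]

theorem card_fixed (k : ℕ) {n n₀ n₁ n₂ : ℕ} (h : n₀ + n₁ + 2 * n₂ = n)
    (σ : (Fin n → ℂˣ) → (Fin n → ℂˣ)) (he : EquivStruct σ (reindex h (stdStructure n₀ n₁ n₂))) :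
    Nat.card {z : Fin n → ℂˣ // z ^ k = 1 ∧ σ z = z} =
      Nat.card {t : ℂˣ // t ^ k = 1 ∧ conjUnits t = t} ^ n₀ *
      (Nat.card {t : ℂˣ // t ^ k = 1 ∧ (conjUnits t)⁻¹ = t} ^ n₁ *
      Nat.card {t : ℂˣ // t ^ k = 1} ^ n₂) := by
  subst h
  obtain ⟨ψ, -, -, hψ⟩ := he
  have e : {z : Fin (n₀ + n₁ + 2 * n₂) → ℂˣ // z ^ k = 1 ∧ σ z = z} ≃
      {z : Fin (n₀ + n₁ + 2 * n₂) → ℂˣ // z ^ k = 1 ∧ stdStructure n₀ n₁ n₂ z = z} := by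
    refine ψ.toEquiv.subtypeEquiv fun z => ?_
    have h2 : stdStructure n₀ n₁ n₂ (ψ z) = ψ (σ z) := by
      have := hψ (ψ z)
      rw [MulEquiv.symm_apply_apply] at this
      exact this
    change _ ↔ (ψ z) ^ k = 1 ∧ stdStructure n₀ n₁ n₂ (ψ z) = ψ z
    rw [h2, ← map_pow, MulEquiv.map_eq_one_iff, ψ.injective.eq_iff]
  rw [Nat.card_congr (e.trans (fixedEquiv k n₀ n₁ n₂))]
  simp [Nat.card_prod, Nat.card_fun]

/-- Every real group structure on an `n`-dimensional complex torus is equivalent to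
exactly one real group structure of the form `σ₀^{×n₀} × σ₁^{×n₁} × σ₂^{×n₂}` with
`n = n₀ + n₁ + 2n₂`. -/
theorem real_structures_on_torus (n : ℕ) (σ : (Fin n → ℂˣ) → (Fin n → ℂˣ))
    (hσ : IsRealGroupStructure σ) :
    ∃! t : ℕ × ℕ × ℕ, ∃ h : t.1 + t.2.1 + 2 * t.2.2 = n,
      EquivStruct σ (reindex h (stdStructure t.1 t.2.1 t.2.2)) := by
  obtain ⟨t, h, he⟩ := exists_std n σ hσ
  refine ⟨t, ⟨h, he⟩, ?_⟩
  rintro t' ⟨h', he'⟩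
  have e2 := (card_fixed 2 h σ he).symm.trans (card_fixed 2 h' σ he')
  have e3 := (card_fixed 3 h σ he).symm.trans (card_fixed 3 h' σ he')
  rw [card_A2, card_B, card_torsion, ← pow_add, ← pow_add, ← pow_add, ← pow_add] at e2
  rw [card_A3, card_B, card_torsion, one_pow, one_pow, one_mul, one_mul, ← pow_add,
    ← pow_add] at e3
  have f2 := Nat.pow_right_injective (le_refl 2) e2
  have f3 := Nat.pow_right_injective (by norm_num : 2 ≤ 3) e3
  refine Prod.ext ?_ (Prod.ext ?_ ?_) <;> omega
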